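/- If f : 𝕋 → 𝕋 is a bicomplex entire (𝕋-holomorphic) function and there exist α, β ∈ 𝕋 with α - β invertible such that for all w, both f(w) - α and f(w) - β are invertible (i.e., the range of f avoids the null-cone translates of α and β), then f is constant. (Bicomplex Picard little theorem, holomorphic case.) -/

import Mathlib

/-- The bicomplex numbers `𝕋`, represented as pairs `(z₁, z₂)` meaning `z₁ + z₂ i₂`. -/
abbrev Bicomplex := ℂ × ℂ

/-- The projection `P₁(z₁ + z₂ i₂) = z₁ - z₂ i₁`. -/
def P1 (w : Bicomplex) : ℂ := w.1 - w.2 * Complex.I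

/-- The projection `P₂(z₁ + z₂ i₂) = z₁ + z₂ i₁`. -/
def P2 (w : Bicomplex) : ℂ := w.1 + w.2 * Complex.I

/-- A bicomplex number is invertible iff both idempotent components are nonzero. -/
def BInvertible (u : Bicomplex) : Prop := P1 u ≠ 0 ∧ P2 u ≠ 0

/-- `f : 𝕋 → 𝕋` is bicomplex entire (`𝕋`-holomorphic on all of `𝕋`) iff it decomposes as
`f(w) = f₁(P₁(w))e₁ + f₂(P₂(w))e₂` with `f₁, f₂ : ℂ → ℂ` entire. -/
def BEntire (f : Bicomplex → Bicomplex) : Prop :=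
  ∃ f₁ f₂ : ℂ → ℂ, Differentiable ℂ f₁ ∧ Differentiable ℂ f₂ ∧
    ∀ w : Bicomplex, P1 (f w) = f₁ (P1 w) ∧ P2 (f w) = f₂ (P2 w)

/-- An entire function without zeros has an entire logarithm. -/
lemma picard_exists_log (f : ℂ → ℂ) (hf : Differentiable ℂ f) (h0 : ∀ z, f z ≠ 0) :
    ∃ g : ℂ → ℂ, Differentiable ℂ g ∧ ∀ z, f z = Complex.exp (g z) := by
  have hd : Differentiable ℂ (fun z => deriv f z / f z) := hf.deriv.div hf h0
  have hex : Complex.IsExactOn (fun z => deriv f z / f z) Set.univ :=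
    Complex.IsConservativeOn.isExactOn_univ hd.continuous
      (DifferentiableOn.isConservativeOn hd.differentiableOn)
  obtain ⟨g, hg0, hg⟩ := hex.with_val_at 0 (Complex.log (f 0))
  have hg' : ∀ z, HasDerivAt g (deriv f z / f z) z := fun z => hg z (Set.mem_univ z)
  have hgd : Differentiable ℂ g := fun z => (hg' z).differentiableAt
  refine ⟨g, hgd, fun z => ?_⟩
  have hder : ∀ z, HasDerivAt (fun z => f z * Complex.exp (-g z)) 0 z := by
    intro z
    have h1 := (hf z).hasDerivAt.mul ((hg' z).neg.cexp)
    refine h1.congr_deriv ?_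
    have := h0 z
    field_simp
    ring
  have hc := is_const_of_deriv_eq_zero (fun z => (hder z).differentiableAt)
    (fun z => (hder z).deriv) z 0
  simp only [hg0, Complex.exp_neg, Complex.exp_log (h0 0)] at hc
  rw [mul_inv_cancel₀ (h0 0)] at hc
  have := Complex.exp_ne_zero (g z)
  field_simp at hc
  exact hc

/-- An entire function omitting `1` and `-1` is of the form `cos (π F)`. -/
lemma picard_exists_cos (f : ℂ → ℂ) (hf : Differentiable ℂ f) (h1 : ∀ z, f z ≠ 1)
    (h2 : ∀ z, f z ≠ -1) :
    ∃ F : ℂ → ℂ, Differentiable ℂ F ∧ ∀ z, f z = Complex.cos (Real.pi * F z) := by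
  obtain ⟨L, hL, hLe⟩ := picard_exists_log (fun z => f z ^ 2 - 1) (by fun_prop) (fun z h => by
    have : (f z - 1) * (f z + 1) = 0 := by linear_combination h
    rcases mul_eq_zero.1 this with h | h
    · exact h1 z (by linear_combination h)
    · exact h2 z (by linear_combination h))
  have hs : ∀ z, Complex.exp (L z / 2) ^ 2 = f z ^ 2 - 1 := by
    intro z
    rw [hLe z, ← Complex.exp_nat_mul]
    congr 1
    push_cast
    ring
  have hprod : ∀ z, (f z + Complex.exp (L z / 2)) * (f z - Complex.exp (L z / 2)) = 1 := by
    intro z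
    linear_combination -hs z
  obtain ⟨M, hM, hMe⟩ := picard_exists_log (fun z => f z + Complex.exp (L z / 2)) (by fun_prop)
    (fun z h => by have := hprod z; rw [h] at this; simp at this)
  refine ⟨fun z => M z / (Complex.I * Real.pi), by fun_prop, fun z => ?_⟩
  have hpi : (Real.pi : ℂ) ≠ 0 := by exact_mod_cast Real.pi_ne_zero
  have e1 : (Real.pi : ℂ) * (M z / (Complex.I * Real.pi)) * Complex.I = M z := by
    field_simp [Complex.I_ne_zero]
  have hm : Complex.exp (-M z) = f z - Complex.exp (L z / 2) := by
    rw [Complex.exp_neg, ← hMe z]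
    exact inv_eq_of_mul_eq_one_right (hprod z)
  rw [Complex.cos, neg_mul, e1, hm, ← hMe z]
  ring

/-- Weak Bloch theorem: if the derivative of an entire function is not zero somewhere, then the
image contains arbitrarily large balls. -/
lemma picard_bloch (f : ℂ → ℂ) (hf : Differentiable ℂ f) (z₀ : ℂ) (h0 : deriv f z₀ ≠ 0)
    (K : ℝ) : ∃ c, Metric.ball c K ⊆ Set.range f := by
  obtain ⟨R, hR, hRK⟩ : ∃ R : ℝ, 0 < R ∧ 64 * K ≤ ‖deriv f z₀‖ * R := by
    have hp : 0 < ‖deriv f z₀‖ := norm_pos_iff.2 h0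
    refine ⟨max 1 (64 * K / ‖deriv f z₀‖), by positivity, ?_⟩
    rw [mul_comm ‖deriv f z₀‖, ← div_le_iff₀ hp]
    exact le_max_right _ _
  have hdc : Differentiable ℂ (deriv f) := hf.deriv
  have hcont : Continuous (fun z => ‖deriv f z‖ * (R - dist z z₀)) := by
    have := hdc.continuous
    fun_prop
  obtain ⟨a, ha, hmax⟩ := (isCompact_closedBall z₀ R).exists_isMaxOn
    ⟨z₀, Metric.mem_closedBall_self hR.le⟩ hcont.continuousOn
  have hmax' : ∀ z, dist z z₀ ≤ R →
      ‖deriv f z‖ * (R - dist z z₀) ≤ ‖deriv f a‖ * (R - dist a z₀) := fun z hz =>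
    hmax (Metric.mem_closedBall.2 hz)
  have hM : ‖deriv f z₀‖ * R ≤ ‖deriv f a‖ * (R - dist a z₀) := by
    simpa using hmax' z₀ (by simpa using hR.le)
  have hMpos : 0 < ‖deriv f a‖ * (R - dist a z₀) :=
    lt_of_lt_of_le (mul_pos (norm_pos_iff.2 h0) hR) hM
  have haR : 0 ≤ R - dist a z₀ := sub_nonneg.2 (Metric.mem_closedBall.1 ha)
  have hDpos : 0 < ‖deriv f a‖ := pos_of_mul_pos_left hMpos haR
  obtain ⟨t, ht⟩ : ∃ t, t = (R - dist a z₀) / 2 := ⟨_, rfl⟩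
  have htpos : 0 < t := by
    have := pos_of_mul_pos_right hMpos hDpos.le
    rw [ht]; linarith
  have hbound : ∀ z ∈ Metric.ball a t, ‖deriv f z‖ ≤ 2 * ‖deriv f a‖ := by
    intro z hz
    have hz' : dist z a < t := hz
    have htri := dist_triangle z a z₀
    have h1 : t ≤ R - dist z z₀ := by linarith
    have h2 := hmax' z (by linarith)
    have h3 : ‖deriv f z‖ * t ≤ (2 * ‖deriv f a‖) * t := by
      calc _ ≤ ‖deriv f z‖ * (R - dist z z₀) := by gcongr
        _ ≤ _ := h2
        _ = _ := by rw [ht]; ring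
    exact le_of_mul_le_mul_right h3 htpos
  have hmaps : Set.MapsTo (deriv f) (Metric.ball a t)
      (Metric.closedBall (deriv f a) (4 * ‖deriv f a‖)) := by
    intro z hz
    rw [Metric.mem_closedBall, dist_eq_norm]
    have := norm_sub_le (deriv f z) (deriv f a)
    have := hbound z hz
    linarith
  have hlip : ∀ z ∈ Metric.closedBall a (t / 8), ‖deriv f z - deriv f a‖ ≤ ‖deriv f a‖ / 2 := by
    intro z hz
    have hz' : dist z a ≤ t / 8 := hz
    have h1 := Complex.dist_le_div_mul_dist_of_mapsTo_ball hdc.differentiableOn hmaps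
      (Metric.mem_ball.2 (by linarith : dist z a < t))
    rw [dist_eq_norm] at h1
    calc _ ≤ _ := h1
      _ ≤ 4 * ‖deriv f a‖ / t * (t / 8) := by gcongr
      _ = _ := by field_simp; norm_num
  have hlow : ∀ z ∈ Metric.sphere a (t / 8), ‖deriv f a‖ * t / 16 ≤ ‖f z - f a‖ := by
    intro z hz
    have hz' : ‖z - a‖ = t / 8 := by rw [← dist_eq_norm]; exact hz
    have hd : ∀ w, HasDerivAt (fun w => f w - deriv f a * w) (deriv f w - deriv f a) w := by
      intro w
      have h := (hf w).hasDerivAt.sub ((hasDerivAt_id w).const_mul (deriv f a))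
      rw [mul_one] at h
      exact h
    have h1 := (convex_closedBall a (t / 8)).norm_image_sub_le_of_norm_hasDerivWithin_le
      (fun w _ => (hd w).hasDerivWithinAt) hlip
      (Metric.mem_closedBall_self (by positivity)) (Metric.sphere_subset_closedBall hz)
    rw [hz'] at h1
    have h2 : deriv f a * (z - a) = (f z - f a) -
      ((f z - deriv f a * z) - (f a - deriv f a * a)) := by ring
    have h3 : ‖deriv f a * (z - a)‖ ≤ ‖f z - f a‖ + _ := h2 ▸ norm_sub_le _ _
    rw [norm_mul, hz'] at h3
    linarith
  refine ⟨f a, ?_⟩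
  have hne : ∃ᶠ z in nhds a, f z ≠ f a := by
    intro hev
    have hev' : f =ᶠ[nhds a] fun _ => f a := by
      filter_upwards [hev] with z hz using not_not.1 hz
    have := hev'.deriv_eq
    rw [deriv_const] at this
    simp [this] at hDpos
  have hsub := DiffContOnCl.ball_subset_image_closedBall hf.diffContOnCl (by positivity) hlow hne
  refine (Metric.ball_subset_ball ?_).trans (hsub.trans (Set.image_subset_range _ _))
  have : ‖deriv f a‖ * (R - dist a z₀) = 2 * (‖deriv f a‖ * t) := by rw [ht]; ring
  linarith

/-- Every point has a point `w` at distance less than `3` with `cos (π w)` an integer. -/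
lemma picard_net (c : ℂ) : ∃ w ∈ Metric.ball c 3, ∃ n : ℤ, Complex.cos (Real.pi * w) = n := by
  obtain ⟨y, hy, n, hn⟩ : ∃ y : ℝ, |y - c.im| ≤ 1 ∧ ∃ n : ℤ, Real.cosh (Real.pi * y) = n := by
    have key : ∀ v : ℝ, 0 ≤ v → ∃ y ∈ Set.Icc v (v + 1), ∃ n : ℤ, Real.cosh (Real.pi * y) = n := by
      intro v hv
      have hcont : ContinuousOn (fun y : ℝ => Real.cosh (Real.pi * y)) (Set.Icc v (v + 1)) := by
        have := Real.continuous_cosh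
        fun_prop
      have hpi := Real.pi_gt_three
      have hstep : Real.cosh (Real.pi * v) + 1 ≤ Real.cosh (Real.pi * (v + 1)) := by
        have e : Real.pi * (v + 1) = Real.pi * v + Real.pi := by ring
        rw [e, Real.cosh_add]
        have h1 : 0 ≤ Real.sinh (Real.pi * v) := Real.sinh_nonneg_iff.2 (by positivity)
        have h2 : 0 ≤ Real.sinh Real.pi := Real.sinh_nonneg_iff.2 (by positivity)
        have h3 : 2 ≤ Real.cosh Real.pi := by
          rw [Real.cosh_eq]
          have := Real.add_one_le_exp Real.pi
          have := Real.exp_pos (-Real.pi)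
          linarith
        have h4 := Real.one_le_cosh (Real.pi * v)
        nlinarith [mul_nonneg h1 h2]
      obtain ⟨y, hy, hye⟩ := intermediate_value_Icc (by linarith) hcont
        (show (⌈Real.cosh (Real.pi * v)⌉ : ℝ) ∈ _ from
          ⟨Int.le_ceil _, (Int.ceil_lt_add_one _).le.trans hstep⟩)
      exact ⟨y, hy, _, hye⟩
    rcases le_total 0 c.im with h | h
    · obtain ⟨y, hy, n, hn⟩ := key _ h
      exact ⟨y, by rw [abs_le]; constructor <;> linarith [hy.1, hy.2], n, hn⟩
    · obtain ⟨y, hy, n, hn⟩ := key (-c.im) (by linarith)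
      refine ⟨-y, by rw [abs_le]; constructor <;> linarith [hy.1, hy.2], n, ?_⟩
      rw [mul_neg, Real.cosh_neg, hn]
  obtain ⟨k, hk⟩ : ∃ k : ℤ, |2 * (k : ℝ) - c.re| ≤ 1 := by
    refine ⟨round (c.re / 2), ?_⟩
    have := abs_sub_round (c.re / 2)
    rw [abs_le] at *
    constructor <;> linarith [this.1, this.2]
  refine ⟨⟨2 * k, y⟩, ?_, n, ?_⟩
  · rw [Metric.mem_ball, dist_eq_norm]
    have := Complex.norm_le_abs_re_add_abs_im ((⟨2 * k, y⟩ : ℂ) - c)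
    simp only [Complex.sub_re, Complex.sub_im] at this
    linarith
  · have e : (Real.pi : ℂ) * (⟨2 * k, y⟩ : ℂ) =
        ((Real.pi * y : ℝ) : ℂ) * Complex.I + k * (2 * Real.pi) := by
      rw [Complex.mk_eq_add_mul_I]
      push_cast
      ring
    rw [e, Complex.cos_add_int_mul_two_pi, Complex.cos_mul_I, ← Complex.ofReal_cosh, hn]
    simp

/-- Little Picard for the omitted values `1` and `-1`. -/
lemma picard_pm_one (f : ℂ → ℂ) (hf : Differentiable ℂ f) (h1 : ∀ z, f z ≠ 1)
    (h2 : ∀ z, f z ≠ -1) (z w : ℂ) : f z = f w := by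
  obtain ⟨F, hF, hFe⟩ := picard_exists_cos f hf h1 h2
  have hFint : ∀ z, ∀ n : ℤ, F z ≠ n := by
    intro z n hn
    have hs : Complex.sin (Real.pi * F z) = 0 := by
      rw [hn, mul_comm]; exact Complex.sin_int_mul_pi n
    have hsq := Complex.sin_sq_add_cos_sq (Real.pi * F z)
    rw [hs, ← hFe z] at hsq
    have : (f z - 1) * (f z + 1) = 0 := by linear_combination hsq
    rcases mul_eq_zero.1 this with h | h
    · exact h1 z (by linear_combination h)
    · exact h2 z (by linear_combination h)
  obtain ⟨G, hG, hGe⟩ := picard_exists_cos F hF (fun z => by simpa using hFint z 1)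
    (fun z => by simpa using hFint z (-1))
  have hGd : ∀ z, deriv G z = 0 := by
    by_contra! hex
    obtain ⟨z₀, hz₀⟩ := hex
    obtain ⟨c, hc⟩ := picard_bloch G hG z₀ hz₀ 3
    obtain ⟨w, hw, n, hn⟩ := picard_net c
    obtain ⟨z, rfl⟩ := hc hw
    exact hFint z n (by rw [hGe z, hn])
  rw [hFe z, hFe w, hGe z, hGe w, is_const_of_deriv_eq_zero hG hGd z w]

/-- Little Picard theorem for entire functions. -/
lemma picard_little (f : ℂ → ℂ) (hf : Differentiable ℂ f) (a b : ℂ) (hab : a - b ≠ 0)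
    (h1 : ∀ z, f z - a ≠ 0) (h2 : ∀ z, f z - b ≠ 0) (z w : ℂ) : f z = f w := by
  have h := picard_pm_one (fun z => (2 * f z - a - b) / (a - b)) (by fun_prop)
    (fun z hz => by
      rw [div_eq_iff hab] at hz
      exact h1 z (by linear_combination hz / 2))
    (fun z hz => by
      rw [div_eq_iff hab] at hz
      exact h2 z (by linear_combination hz / 2)) z w
  rw [div_left_inj' hab] at h
  linear_combination h / 2

/-- Bicomplex little Picard theorem (holomorphic case). -/
theorem bicomplex_little_picard (f : Bicomplex → Bicomplex) (hf : BEntire f)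
    (α β : Bicomplex) (hαβ : BInvertible (α - β))
    (havoid : ∀ w : Bicomplex, BInvertible (f w - α) ∧ BInvertible (f w - β)) :
    ∀ w w' : Bicomplex, f w = f w' := by
  obtain ⟨f₁, f₂, hf₁, hf₂, hfe⟩ := hf
  have hs1 : ∀ u v : Bicomplex, P1 (u - v) = P1 u - P1 v := by
    intro u v; simp only [P1, Prod.fst_sub, Prod.snd_sub]; ring
  have hs2 : ∀ u v : Bicomplex, P2 (u - v) = P2 u - P2 v := by
    intro u v; simp only [P2, Prod.fst_sub, Prod.snd_sub]; ring
  have hp1 : ∀ z : ℂ, P1 (z, 0) = z := by intro z; simp [P1]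
  have hp2 : ∀ z : ℂ, P2 (z, 0) = z := by intro z; simp [P2]
  have c1 := picard_little f₁ hf₁ (P1 α) (P1 β) (by rw [← hs1]; exact hαβ.1)
    (fun z => by have := (havoid (z, 0)).1.1; rwa [hs1, (hfe _).1, hp1] at this)
    (fun z => by have := (havoid (z, 0)).2.1; rwa [hs1, (hfe _).1, hp1] at this)
  have c2 := picard_little f₂ hf₂ (P2 α) (P2 β) (by rw [← hs2]; exact hαβ.2)
    (fun z => by have := (havoid (z, 0)).1.2; rwa [hs2, (hfe _).2, hp2] at this)
    (fun z => by have := (havoid (z, 0)).2.2; rwa [hs2, (hfe _).2, hp2] at this)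
  intro w w'
  have e1 : P1 (f w) = P1 (f w') := by rw [(hfe w).1, (hfe w').1]; exact c1 _ _
  have e2 : P2 (f w) = P2 (f w') := by rw [(hfe w).2, (hfe w').2]; exact c2 _ _
  simp only [P1, P2] at e1 e2
  refine Prod.ext (by linear_combination (e1 + e2) / 2) ?_
  have : (f w).2 * Complex.I = (f w').2 * Complex.I := by linear_combination (e2 - e1) / 2
  exact mul_right_cancel₀ Complex.I_ne_zero this
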